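/- arXiv:2302.13882 — 2 statements merged into one kernel-verified Lean document; each statement's English description precedes it below -/
import Mathlib

section
/- Quadrature identity for the hippopede (Neumann oval): let a > b > 0, c = √(a² − b²), and let Ω = {x + i y ∈ ℂ : a²b²(x² + y²)² < b²x² + a²y²}, the domain bounded by the inversion of the ellipse x²/a² + y²/b² = 1 under the antipodal map (note 0 ∉ Ω; the origin is a special point). For every h holomorphic on Ω with ∫_Ω |h(z)| dA(z) < ∞ one has (1/π) ∫_Ω h(z) dA(z) = ((a² + b²)/(4a²b²)) ( h(ic/(2ab)) + h(−ic/(2ab)) ). -/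
open MeasureTheory Set Filter Topology Metric Function

/-- Polar coordinates adapted to a domain which is star-shaped about the origin. -/
theorem integral_eq_radial_integral {R R' : ℝ → ℝ} (hR : ∀ θ, HasDerivAt R (R' θ) θ)
    (hpos : ∀ θ, 0 < R θ) {f : ℂ → ℂ} {S : Set ℂ}
    (hS : ∀ s θ : ℝ, 0 < s →
      (((s * R θ : ℝ) : ℂ) * Complex.exp (θ * Complex.I) ∈ S ↔ s < 1))
    (hf : IntegrableOn f S) :
    ∫ z in S, f z = ∫ s in Ioo (0 : ℝ) 1, ∫ θ in Ioo (-Real.pi) Real.pi,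
      (s * R θ ^ 2) • f (((s * R θ : ℝ) : ℂ) * Complex.exp (θ * Complex.I)) := by
  set T : Set (ℝ × ℝ) := Ioo (0 : ℝ) 1 ×ˢ Ioo (-Real.pi) Real.pi with hT
  set Ψ : ℝ × ℝ → ℝ × ℝ := fun p => (p.1 * R p.2, p.2) with hΨ
  set e := Complex.measurableEquivRealProd.symm with he
  have heq : ∀ p : ℝ × ℝ, e (polarCoord.symm (Ψ p)) =
      ((p.1 * R p.2 : ℝ) : ℂ) * Complex.exp (p.2 * Complex.I) := fun p => by
    rw [he, Complex.measurableEquivRealProd_symm_polarCoord_symm_apply,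
      Complex.polarCoord_symm_apply, Complex.exp_mul_I]
    simp [hΨ]
  have hmp : MeasurePreserving e := Complex.volume_preserving_equiv_real_prod.symm
  have hΨ' : ∀ p ∈ T, HasFDerivWithinAt (polarCoord.symm ∘ Ψ)
      ((fderivPolarCoordSymm (Ψ p)).comp
        (LinearMap.toContinuousLinearMap (Matrix.toLin (Module.Basis.finTwoProd ℝ)
          (Module.Basis.finTwoProd ℝ) !![R p.2, p.1 * R' p.2; 0, 1]))) T p := fun p _ => by
    refine ((hasFDerivAt_polarCoord_symm (Ψ p)).comp p ?_).hasFDerivWithinAt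
    rw [Matrix.toLin_finTwoProd_toContinuousLinearMap]
    convert! HasFDerivAt.prodMk (𝕜 := ℝ)
      (hasFDerivAt_fst.mul ((hR p.2).comp_hasFDerivAt p hasFDerivAt_snd)) hasFDerivAt_snd using 2
    · simp [smul_smul, add_comm]
    · simp
  have hΨt : ∀ p ∈ T, Ψ p ∈ polarCoord.target := fun p hp =>
    ⟨mul_pos hp.1.1 (hpos _), hp.2⟩
  have hinj : InjOn (polarCoord.symm ∘ Ψ) T := by
    refine polarCoord.symm.injOn.comp ?_ hΨt
    intro p _ q _ hpq
    simp only [hΨ, Prod.mk.injEq] at hpq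
    obtain ⟨h1, h2⟩ := hpq
    rw [h2] at h1
    exact Prod.ext (mul_right_cancel₀ (hpos _).ne' h1) h2
  have himg : (polarCoord.symm ∘ Ψ) '' T = (e ⁻¹' S) ∩ polarCoord.source := by
    ext q
    constructor
    · rintro ⟨p, hp, rfl⟩
      refine ⟨?_, polarCoord.map_target (hΨt p hp)⟩
      rw [mem_preimage, comp_apply, heq, hS _ _ hp.1.1]
      exact hp.1.2
    · rintro ⟨hq, hqs⟩
      set u := polarCoord q with hu
      have hut : u ∈ polarCoord.target := polarCoord.map_source hqs
      have hq' : polarCoord.symm u = q := polarCoord.left_inv hqs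
      have hΨu : Ψ (u.1 / R u.2, u.2) = u :=
        Prod.ext (div_mul_cancel₀ _ (hpos _).ne') rfl
      have hs : 0 < u.1 / R u.2 := div_pos hut.1 (hpos _)
      refine ⟨(u.1 / R u.2, u.2), ⟨⟨hs, ?_⟩, hut.2⟩, by rw [comp_apply, hΨu, hq']⟩
      rw [← hS _ u.2 hs, ← heq (u.1 / R u.2, u.2), hΨu, hq']
      exact hq
  have hae : (polarCoord.symm ∘ Ψ) '' T =ᵐ[volume] e ⁻¹' S := by
    rw [himg]
    simpa using (ae_eq_refl (e ⁻¹' S)).inter polarCoord_source_ae_eq_univ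
  have hTm : MeasurableSet T := measurableSet_Ioo.prod measurableSet_Ioo
  have hint : IntegrableOn (f ∘ e) ((polarCoord.symm ∘ Ψ) '' T) :=
    ((hmp.integrableOn_comp_preimage e.measurableEmbedding).2 hf).congr_set_ae hae
  rw [integrableOn_image_iff_integrableOn_abs_det_fderiv_smul volume hTm hΨ' hinj] at hint
  have hcongr : ∀ p ∈ T, |((fderivPolarCoordSymm (Ψ p)).comp
        (LinearMap.toContinuousLinearMap (Matrix.toLin (Module.Basis.finTwoProd ℝ)
          (Module.Basis.finTwoProd ℝ) !![R p.2, p.1 * R' p.2; 0, 1]))).det| •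
        (f ∘ e) ((polarCoord.symm ∘ Ψ) p) =
      (p.1 * R p.2 ^ 2) • f (((p.1 * R p.2 : ℝ) : ℂ) * Complex.exp (p.2 * Complex.I)) := by
    intro p hp
    rw [comp_apply, comp_apply, heq]
    congr 1
    have : ((fderivPolarCoordSymm (Ψ p)).comp
        (LinearMap.toContinuousLinearMap (Matrix.toLin (Module.Basis.finTwoProd ℝ)
          (Module.Basis.finTwoProd ℝ) !![R p.2, p.1 * R' p.2; 0, 1]))).det =
        (p.1 * R p.2) * R p.2 := by
      rw [ContinuousLinearMap.det, ContinuousLinearMap.toLinearMap_comp, LinearMap.det_comp]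
      congr 1
      · exact det_fderivPolarCoordSymm (Ψ p)
      · simp [Matrix.det_fin_two_of]
    rw [this, abs_of_pos (mul_pos (mul_pos hp.1.1 (hpos _)) (hpos _))]
    ring
  calc ∫ z in S, f z = ∫ p in e ⁻¹' S, (f ∘ e) p :=
        (hmp.setIntegral_preimage_emb e.measurableEmbedding f S).symm
    _ = ∫ p in (polarCoord.symm ∘ Ψ) '' T, (f ∘ e) p := (setIntegral_congr_set hae).symm
    _ = _ := integral_image_eq_integral_abs_det_fderiv_smul volume hTm hΨ' hinj _
    _ = ∫ p in T, (p.1 * R p.2 ^ 2) •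
          f (((p.1 * R p.2 : ℝ) : ℂ) * Complex.exp (p.2 * Complex.I)) :=
        setIntegral_congr_fun hTm hcongr
    _ = _ := setIntegral_prod _ (hint.congr_fun hcongr hTm)

theorem setIntegral_Ioo_neg_pi_pi_eq {F : ℝ → ℂ} (hF : F.Periodic (2 * Real.pi)) :
    ∫ θ in Ioo (-Real.pi) Real.pi, F θ = ∫ θ in (0 : ℝ)..2 * Real.pi, F θ := by
  rw [← integral_Ioc_eq_integral_Ioo, ← intervalIntegral.integral_of_le (by linarith [Real.pi_pos])]
  have := hF.intervalIntegral_add_eq (-Real.pi) 0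
  rw [zero_add] at this
  rw [← this]
  ring_nf

theorem integral_ball_eq_of_differentiableOn {f : ℂ → ℂ} {c : ℂ} {ρ : ℝ} (hρ : 0 < ρ)
    (hd : DifferentiableOn ℂ f (ball c ρ)) (hf : IntegrableOn f (ball c ρ)) :
    ∫ z in ball c ρ, f z = ((Real.pi * ρ ^ 2 : ℝ) : ℂ) * f c := by
  have hpre : (fun z => c + z) ⁻¹' ball c ρ = ball 0 ρ := by
    ext z; simp
  have hmp : MeasurePreserving (fun z : ℂ => c + z) := measurePreserving_add_left volume c
  have hme : MeasurableEmbedding (fun z : ℂ => c + z) := measurableEmbedding_addLeft c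
  have hf' : IntegrableOn (fun z => f (c + z)) (ball 0 ρ) := by
    rw [← hpre]
    exact (hmp.integrableOn_comp_preimage hme).2 hf
  rw [← hmp.setIntegral_preimage_emb hme, hpre,
    integral_eq_radial_integral (R := fun _ => ρ) (R' := fun _ => 0)
      (fun θ => hasDerivAt_const θ ρ) (fun _ => hρ) ?_ hf']
  · have key : ∀ s ∈ Ioo (0 : ℝ) 1, ∫ θ in Ioo (-Real.pi) Real.pi,
        (s * ρ ^ 2) • f (c + ((s * ρ : ℝ) : ℂ) * Complex.exp (θ * Complex.I)) =
        ((2 * Real.pi * ρ ^ 2 * s : ℝ) : ℂ) * f c := by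
      intro s hs
      have hsρ : 0 < s * ρ := mul_pos hs.1 hρ
      have hav : Real.circleAverage f c (s * ρ) = f c := by
        refine DiffContOnCl.circleAverage (DifferentiableOn.diffContOnCl ?_)
        refine hd.mono ((closure_ball_subset_closedBall).trans (closedBall_subset_ball ?_))
        rw [abs_of_pos hsρ]
        nlinarith [hs.2]
      rw [integral_smul, setIntegral_Ioo_neg_pi_pi_eq (F := fun θ => f (c + ((s * ρ : ℝ) : ℂ) *
        Complex.exp (θ * Complex.I))) ((periodic_circleMap c (s * ρ)).comp f)]
      have := congrArg ((2 * Real.pi) • ·) hav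
      simp only [Real.circleAverage_def, smul_smul] at this
      rw [mul_inv_cancel₀ (by positivity), one_smul] at this
      rw [show (∫ θ in (0 : ℝ)..2 * Real.pi, f (c + ((s * ρ : ℝ) : ℂ) *
        Complex.exp (θ * Complex.I))) = (2 * Real.pi) • f c from this]
      simp only [Complex.real_smul]
      push_cast
      ring
    rw [setIntegral_congr_fun measurableSet_Ioo key, integral_mul_const, integral_complex_ofReal]
    congr 2
    rw [← integral_Ioc_eq_integral_Ioo, ← intervalIntegral.integral_of_le zero_le_one,
      intervalIntegral.integral_const_mul, integral_id]
    ring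
  · intro s θ hs
    rw [mem_ball_zero_iff, norm_mul, Complex.norm_exp_ofReal_mul_I, mul_one, Complex.norm_real,
      Real.norm_of_nonneg (by positivity)]
    exact ⟨fun h => by nlinarith, fun h => by nlinarith⟩

/-- The interior of a limaçon, punctured at the origin. -/
def puncturedLimacon (A β : ℝ) : Set ℂ := {w | ‖w‖ ^ 2 < A * ‖w‖ + 2 * β * w.re}

theorem norm_sq_quadratic_le {A β : ℝ} (hA : 2 * |β| < A) {ζ : ℂ} (hζ : ‖ζ‖ ≤ 1) :
    ‖β + A * ζ + β * ζ ^ 2‖ ^ 2 ≤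
      A * ‖β + A * ζ + β * ζ ^ 2‖ + 2 * β * (β + A * ζ + β * ζ ^ 2 : ℂ).re := by
  obtain ⟨x, y⟩ := ζ
  set w : ℂ := β + A * ⟨x, y⟩ + β * ⟨x, y⟩ ^ 2 with hw
  have hre : w.re = β + A * x + β * (x ^ 2 - y ^ 2) := by simp [hw, pow_two]
  have him : w.im = A * y + β * (2 * x * y) := by simp [hw, pow_two]; left; ring
  have hxy : x ^ 2 + y ^ 2 ≤ 1 := by
    have := Complex.sq_norm (⟨x, y⟩ : ℂ)
    rw [Complex.normSq_mk] at this
    nlinarith [norm_nonneg (⟨x, y⟩ : ℂ)]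
  have hn : ‖w‖ ^ 2 = w.re ^ 2 + w.im ^ 2 := by
    rw [Complex.sq_norm, Complex.normSq_apply]; ring
  have hA0 : 0 < A := lt_of_le_of_lt (by positivity) hA
  have h1 : 0 ≤ (A + β * x) ^ 2 + (β * y) ^ 2 - β ^ 2 := by
    have hx : |x| ≤ 1 := abs_le_one_iff_mul_self_le_one.2 (by nlinarith [sq_nonneg y])
    have h2 : -|β| ≤ β * x := by
      have : |β * x| ≤ |β| := by
        rw [abs_mul]; exact mul_le_of_le_one_right (abs_nonneg _) hx
      linarith [neg_abs_le (β * x)]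
    have h3 : |β| ≤ A + β * x := by linarith
    nlinarith [sq_abs β, abs_nonneg β, sq_nonneg (β * y)]
  have key : (w.re ^ 2 + w.im ^ 2 - 2 * β * w.re) ^ 2 ≤ (A * ‖w‖) ^ 2 := by
    rw [mul_pow, hn, hre, him, ← sub_nonneg]
    have : 0 ≤ (1 - (x ^ 2 + y ^ 2)) * ((A + β * x) ^ 2 + (β * y) ^ 2 - β ^ 2) *
        ((A * x + β * (1 + x ^ 2 + y ^ 2)) ^ 2 + (A * y) ^ 2) :=
      mul_nonneg (mul_nonneg (by linarith) h1) (by positivity)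
    refine this.trans_eq ?_
    ring
  have := abs_le_of_sq_le_sq key (by positivity)
  rw [hn]
  linarith [le_abs_self (w.re ^ 2 + w.im ^ 2 - 2 * β * w.re)]

theorem smul_mem_insert_puncturedLimacon {A β t : ℝ} {w : ℂ}
    (hw : ‖w‖ ^ 2 ≤ A * ‖w‖ + 2 * β * w.re) (ht₀ : 0 ≤ t) (ht : t < 1) :
    (t : ℂ) * w ∈ insert 0 (puncturedLimacon A β) := by
  rcases eq_or_ne ((t : ℂ) * w) 0 with h | h
  · exact Or.inl h
  · right
    obtain ⟨h1, h2⟩ := mul_ne_zero_iff.1 h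
    have ht' : 0 < t := lt_of_le_of_ne ht₀ (by rintro rfl; simp at h1)
    have hw' : 0 < ‖w‖ := norm_pos_iff.2 h2
    simp only [puncturedLimacon, mem_ofPred_eq, norm_mul, Complex.norm_real, Complex.re_ofReal_mul,
      Real.norm_of_nonneg ht₀]
    have h3 : t * ‖w‖ ^ 2 < ‖w‖ ^ 2 := by nlinarith [pow_pos hw' 2]
    nlinarith

theorem zero_notMem_puncturedLimacon {A β : ℝ} : (0 : ℂ) ∉ puncturedLimacon A β := by
  simp [puncturedLimacon]

theorem isOpen_puncturedLimacon {A β : ℝ} : IsOpen (puncturedLimacon A β) :=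
  isOpen_lt (by fun_prop) (by fun_prop)

theorem ball_subset_insert_puncturedLimacon {A β : ℝ} :
    ball (0 : ℂ) (A - 2 * |β|) ⊆ insert 0 (puncturedLimacon A β) := by
  intro w hw
  rw [mem_ball_zero_iff] at hw
  rcases eq_or_ne w 0 with h | h
  · exact Or.inl h
  · right
    have hw' : 0 < ‖w‖ := norm_pos_iff.2 h
    have h1 : |β * w.re| ≤ |β| * ‖w‖ := by
      rw [abs_mul]; exact mul_le_mul_of_nonneg_left (Complex.abs_re_le_norm w) (abs_nonneg _)
    have h2 := neg_abs_le (β * w.re)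
    change ‖w‖ ^ 2 < A * ‖w‖ + 2 * β * w.re
    nlinarith

theorem isOpen_insert_puncturedLimacon {A β : ℝ} (hA : 2 * |β| < A) :
    IsOpen (insert 0 (puncturedLimacon A β)) := by
  have : insert 0 (puncturedLimacon A β) = ball 0 (A - 2 * |β|) ∪ puncturedLimacon A β := by
    refine Subset.antisymm (insert_subset (Or.inl (by simpa using hA)) subset_union_right) ?_
    exact union_subset ball_subset_insert_puncturedLimacon (subset_insert _ _)
  rw [this]
  exact isOpen_ball.union isOpen_puncturedLimacon

theorem ofReal_mem_puncturedLimacon {A β : ℝ} (hA : 2 * |β| < A) (hβ : β < 0) :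
    (β : ℂ) ∈ puncturedLimacon A β := by
  have h1 : |β| = -β := abs_of_neg hβ
  simp only [puncturedLimacon, mem_ofPred_eq, Complex.norm_real, Real.norm_eq_abs, h1,
    Complex.ofReal_re]
  rw [h1] at hA
  nlinarith

theorem integral_limacon_circle {A β s : ℝ} (hA : 2 * |β| < A) (hs₀ : 0 < s) (hs : s < 1)
    {H : ℂ → ℂ} (hH : DifferentiableOn ℂ H (insert 0 (puncturedLimacon A β))) :
    ∫ φ in (0 : ℝ)..2 * Real.pi, ((A + 2 * β * Real.cos φ : ℝ) : ℂ) *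
        H (((s ^ 2 * (A + 2 * β * Real.cos φ) : ℝ) : ℂ) * Complex.exp (φ * Complex.I)) =
      2 * Real.pi * A * (H (s ^ 2 * β) + s ^ 2 * β * deriv H (s ^ 2 * β)) := by
  set P : ℂ → ℂ := fun ζ => β + A * ζ + β * ζ ^ 2 with hP
  set W := insert 0 (puncturedLimacon A β) with hWdef
  have hW : IsOpen W := isOpen_insert_puncturedLimacon hA
  set U : Set ℂ := (fun ζ => ((s ^ 2 : ℝ) : ℂ) * P ζ) ⁻¹' W with hUdef
  have hPd : Differentiable ℂ P := by fun_prop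
  have hPd' : Differentiable ℂ (fun ζ => ((s ^ 2 : ℝ) : ℂ) * P ζ) := by fun_prop
  have hU : IsOpen U := hW.preimage hPd'.continuous
  have hsub : closedBall 0 1 ⊆ U := fun ζ hζ =>
    smul_mem_insert_puncturedLimacon (norm_sq_quadratic_le hA (by simpa using hζ))
      (by positivity) (by nlinarith)
  have hdiff : DifferentiableOn ℂ (fun ζ => H (((s ^ 2 : ℝ) : ℂ) * P ζ) * P ζ) U :=
    (hH.comp hPd'.differentiableOn fun _ h => h).mul hPd.differentiableOn
  have hC := Complex.two_pi_I_inv_smul_circleIntegral_sub_sq_inv_smul_of_differentiable hU hsub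
    hdiff (mem_ball_self one_pos)
  have h0 : P 0 = β := by simp [hP]
  have hPder : HasDerivAt P A 0 := by
    have := (((hasDerivAt_id (0 : ℂ)).const_mul (A : ℂ)).const_add (β : ℂ)).add
      (((hasDerivAt_id (0 : ℂ)).pow 2).const_mul (β : ℂ))
    convert! this using 1
    simp
  have hβ : ((s ^ 2 : ℝ) : ℂ) * P 0 ∈ W := hsub (by simp)
  have hHd : HasDerivAt H (deriv H (((s ^ 2 : ℝ) : ℂ) * P 0)) (((s ^ 2 : ℝ) : ℂ) * P 0) :=
    (hH.differentiableAt (hW.mem_nhds hβ)).hasDerivAt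
  have hder := ((hHd.comp (0 : ℂ) (hPder.const_mul ((s ^ 2 : ℝ) : ℂ))).mul hPder).deriv
  have hci : (∮ z in C(0, 1), ((z - 0) ^ 2)⁻¹ • (H (((s ^ 2 : ℝ) : ℂ) * P z) * P z)) =
      Complex.I * ∫ φ in (0 : ℝ)..2 * Real.pi, ((A + 2 * β * Real.cos φ : ℝ) : ℂ) *
        H (((s ^ 2 * (A + 2 * β * Real.cos φ) : ℝ) : ℂ) * Complex.exp (φ * Complex.I)) := by
    rw [circleIntegral, ← intervalIntegral.integral_const_mul]
    refine intervalIntegral.integral_congr fun φ _ => ?_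
    have hE : Complex.exp (φ * Complex.I) ≠ 0 := Complex.exp_ne_zero _
    have hcos : P (Complex.exp (φ * Complex.I)) =
        ((A + 2 * β * Real.cos φ : ℝ) : ℂ) * Complex.exp (φ * Complex.I) := by
      push_cast
      rw [Complex.cos, neg_mul, Complex.exp_neg]
      simp only [hP]
      field_simp
      ring
    simp only [deriv_circleMap, circleMap, sub_zero, zero_add, Complex.ofReal_one, one_mul,
      smul_eq_mul]
    rw [hcos, Complex.ofReal_mul (s ^ 2), mul_assoc ((s ^ 2 : ℝ) : ℂ)]
    field_simp
  rw [hci] at hC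
  have hC' := hC.trans hder
  simp only [comp_apply, h0] at hC'
  have hpi : (Real.pi : ℂ) ≠ 0 := by exact_mod_cast Real.pi_ne_zero
  rw [smul_eq_mul, inv_mul_eq_iff_eq_mul₀ (by simp [hpi])] at hC'
  refine mul_left_cancel₀ Complex.I_ne_zero (hC'.trans ?_)
  push_cast
  ring

theorem integral_deriv_rescaled {A β : ℝ} (hA : 2 * |β| < A) (hβ : β < 0)
    {H : ℂ → ℂ} (hH : DifferentiableOn ℂ H (insert 0 (puncturedLimacon A β))) :
    ∫ s in Ioo (0 : ℝ) 1, (s : ℂ) *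
        (2 * Real.pi * A * (H (s ^ 2 * β) + s ^ 2 * β * deriv H (s ^ 2 * β))) =
      Real.pi * A * H β := by
  have hW : IsOpen (insert 0 (puncturedLimacon A β)) := isOpen_insert_puncturedLimacon hA
  have hmem1 : (β : ℂ) ∈ puncturedLimacon A β := ofReal_mem_puncturedLimacon hA hβ
  have hmem : ∀ s ∈ Icc (0 : ℝ) 1, ((s : ℂ) ^ 2 * β) ∈ insert 0 (puncturedLimacon A β) := by
    intro s hs
    rcases hs.2.eq_or_lt with rfl | h
    · simpa using Or.inr hmem1
    · have := smul_mem_insert_puncturedLimacon (t := s ^ 2) (le_of_lt hmem1) (by positivity)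
        (by nlinarith [hs.1])
      simpa using this
  rw [← integral_Ioc_eq_integral_Ioo, ← intervalIntegral.integral_of_le zero_le_one]
  have hmaps : MapsTo (fun s : ℝ => (s : ℂ) ^ 2 * β) (uIcc 0 1)
      (insert 0 (puncturedLimacon A β)) := by
    rw [uIcc_of_le zero_le_one]; exact hmem
  have hc : Continuous (fun s : ℝ => (s : ℂ) ^ 2 * β) := by fun_prop
  have hHc := hH.continuousOn.comp hc.continuousOn hmaps
  have hHc' := (hH.deriv hW).continuousOn.comp hc.continuousOn hmaps
  rw [intervalIntegral.integral_eq_sub_of_hasDerivAt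
    (f := fun s : ℝ => (Real.pi * A : ℂ) * ((s : ℂ) ^ 2 * H ((s : ℂ) ^ 2 * β)))]
  · simp
  · intro s hs
    have hHd : HasDerivAt H (deriv H ((s : ℂ) ^ 2 * β)) ((s : ℂ) ^ 2 * β) :=
      (hH.differentiableAt (hW.mem_nhds (hmaps hs))).hasDerivAt
    have h2 : HasDerivAt (fun z : ℂ => z ^ 2) (2 * (s : ℂ)) (s : ℂ) := by
      simpa using hasDerivAt_pow 2 (s : ℂ)
    have := (((h2.mul (hHd.comp (s : ℂ) (h2.mul_const (β : ℂ)))).const_mul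
      (Real.pi * A : ℂ))).comp_ofReal
    convert! this using 1
    simp only [comp_apply]
    ring
  · refine ContinuousOn.intervalIntegrable ?_
    have h1 : ContinuousOn (fun s : ℝ => (s : ℂ)) (uIcc 0 1) := by fun_prop
    have h2 : ContinuousOn (fun s : ℝ => (s : ℂ) ^ 2 * (β : ℂ)) (uIcc 0 1) := by fun_prop
    exact h1.mul (continuousOn_const.mul (hHc.add (h2.mul hHc')))

/-- The preimage of the punctured limaçon under squaring. -/
def puncturedHippopede (A β : ℝ) : Set ℂ := (fun z => z ^ 2) ⁻¹' puncturedLimacon A β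

theorem isOpen_puncturedHippopede {A β : ℝ} : IsOpen (puncturedHippopede A β) :=
  isOpen_puncturedLimacon.preimage (continuous_pow 2)

theorem neg_mem_puncturedHippopede {A β : ℝ} {z : ℂ} :
    -z ∈ puncturedHippopede A β ↔ z ∈ puncturedHippopede A β := by
  simp [puncturedHippopede]

/-- An integrable holomorphic function is `o(|z|⁻²)` at a point singularity. -/
theorem isLittleO_inv_sq_of_integrableOn {f : ℂ → ℂ} {S : Set ℂ}
    (h0 : insert 0 S ∈ 𝓝 (0 : ℂ)) (hd : DifferentiableOn ℂ f S) (hf : IntegrableOn f S) :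
    f =o[𝓝[≠] 0] fun z => (z ^ 2)⁻¹ := by
  obtain ⟨δ, hδ, hball⟩ := Metric.mem_nhds_iff.1 h0
  have htend : Tendsto (fun r : ℝ => ∫ z in S ∩ ball 0 r, ‖f z‖) (𝓝[>] 0) (𝓝 0) := by
    have hvol : Tendsto (fun r : ℝ => volume.restrict S (ball (0 : ℂ) r)) (𝓝[>] 0) (𝓝 0) := by
      have h1 : Tendsto (fun r : ℝ => volume (ball (0 : ℂ) r)) (𝓝[>] 0) (𝓝 0) := by
        simp only [Complex.volume_ball]
        have : Tendsto (fun r : ℝ => ENNReal.ofReal r ^ 2 * NNReal.pi) (𝓝 0)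
            (𝓝 (ENNReal.ofReal 0 ^ 2 * NNReal.pi)) :=
          ENNReal.Tendsto.mul_const ((ENNReal.continuous_pow 2).tendsto _ |>.comp
            (ENNReal.continuous_ofReal.tendsto 0)) (Or.inr ENNReal.coe_ne_top)
        simp only [ENNReal.ofReal_zero, ne_eq, OfNat.ofNat_ne_zero, not_false_eq_true, zero_pow,
          zero_mul] at this
        exact this.mono_left nhdsWithin_le_nhds
      exact tendsto_of_tendsto_of_tendsto_of_le_of_le tendsto_const_nhds h1
        (fun _ => zero_le) (fun _ => Measure.restrict_apply_le _ _)
    have := hf.norm.tendsto_setIntegral_nhds_zero hvol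
    refine this.congr fun r => ?_
    rw [Measure.restrict_restrict measurableSet_ball, inter_comm]
  rw [Asymptotics.isLittleO_iff]
  intro ε hε
  have hev : ∀ᶠ z : ℂ in 𝓝[≠] 0, ∫ w in S ∩ ball 0 (2 * ‖z‖), ‖f w‖ < ε * (Real.pi / 4) := by
    have hn : Tendsto (fun z : ℂ => 2 * ‖z‖) (𝓝[≠] 0) (𝓝[>] 0) := by
      refine tendsto_nhdsWithin_iff.2 ⟨?_, ?_⟩
      · have : Continuous fun z : ℂ => 2 * ‖z‖ := by fun_prop
        simpa using (this.tendsto 0).mono_left nhdsWithin_le_nhds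
      · filter_upwards [self_mem_nhdsWithin] with z hz
        have : 0 < ‖z‖ := norm_pos_iff.2 hz
        exact mul_pos two_pos this
    exact (htend.comp hn).eventually_lt_const (by positivity)
  filter_upwards [hev, self_mem_nhdsWithin,
    mem_nhdsWithin_of_mem_nhds (ball_mem_nhds (0 : ℂ) (half_pos hδ))] with z hz hz0 hzδ
  have hzpos : 0 < ‖z‖ := norm_pos_iff.2 hz0
  rw [mem_ball_zero_iff] at hzδ
  have hsub' : ball z (‖z‖ / 2) ⊆ ball 0 (2 * ‖z‖) := by
    refine ball_subset_ball' ?_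
    rw [dist_zero_right]
    linarith
  have hsub : ball z (‖z‖ / 2) ⊆ S := by
    intro w hw
    have h1 := hsub' hw
    rcases hball (ball_subset_ball (by linarith) h1) with rfl | h
    · rw [mem_ball, dist_comm, dist_zero_right] at hw
      linarith
    · exact h
  have hmv := integral_ball_eq_of_differentiableOn (half_pos hzpos) (hd.mono hsub)
    (hf.mono_set hsub)
  have hle : Real.pi * (‖z‖ / 2) ^ 2 * ‖f z‖ ≤ ε * (Real.pi / 4) := by
    calc Real.pi * (‖z‖ / 2) ^ 2 * ‖f z‖ = ‖∫ w in ball z (‖z‖ / 2), f w‖ := by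
          rw [hmv, norm_mul, Complex.norm_real, Real.norm_of_nonneg (by positivity)]
      _ ≤ ∫ w in ball z (‖z‖ / 2), ‖f w‖ := norm_integral_le_integral_norm _
      _ ≤ ∫ w in S ∩ ball 0 (2 * ‖z‖), ‖f w‖ :=
          setIntegral_mono_set (IntegrableOn.mono_set (Integrable.norm hf) inter_subset_left)
            (Eventually.of_forall fun _ => norm_nonneg _)
            (subset_inter hsub hsub').eventuallyLE
      _ ≤ _ := hz.le
  rw [norm_inv, norm_pow, ← div_eq_mul_inv, le_div_iff₀ (by positivity)]
  have : Real.pi / 4 * (‖f z‖ * ‖z‖ ^ 2) ≤ Real.pi / 4 * ε := by linarith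
  exact le_of_mul_le_mul_left this (by positivity)

theorem cpow_half_sq (w : ℂ) : (w ^ (1 / 2 : ℂ)) ^ 2 = w := by
  rw [← Complex.cpow_nat_mul]; norm_num

/-- An even integrable holomorphic function on the punctured hippopede is a holomorphic function
of `z ^ 2`, without singularity at the origin. -/
theorem exists_differentiableOn_comp_sq {A β : ℝ} (hA : 2 * |β| < A) {f : ℂ → ℂ}
    (heven : ∀ z, f (-z) = f z) (hd : DifferentiableOn ℂ f (puncturedHippopede A β))
    (hf : IntegrableOn f (puncturedHippopede A β)) :
    ∃ H : ℂ → ℂ, DifferentiableOn ℂ H (insert 0 (puncturedLimacon A β)) ∧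
      ∀ z ∈ puncturedHippopede A β, H (z ^ 2) = f z := by
  set G : ℂ → ℂ := fun w => f (w ^ (1 / 2 : ℂ)) with hG
  have hGsq : ∀ z, G (z ^ 2) = f z := by
    intro z
    rcases sq_eq_sq_iff_eq_or_eq_neg.1 (cpow_half_sq (z ^ 2)) with h | h
    · simp only [hG, h]
    · simp only [hG, h, heven]
  have hmem : ∀ {w u : ℂ}, w ∈ puncturedLimacon A β → u ^ 2 = w → u ∈ puncturedHippopede A β := by
    rintro w u hw rfl
    exact hw
  have hGd : DifferentiableOn ℂ G (puncturedLimacon A β) := by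
    intro w hw
    refine DifferentiableAt.differentiableWithinAt ?_
    have hw0 : w ≠ 0 := by
      rintro rfl
      exact zero_notMem_puncturedLimacon hw
    rcases Complex.mem_slitPlane_or_neg_mem_slitPlane hw0 with h | h
    · exact DifferentiableAt.comp (g := f) (f := fun w : ℂ => w ^ (1 / 2 : ℂ)) w
        (hd.differentiableAt (isOpen_puncturedHippopede.mem_nhds (hmem hw (cpow_half_sq w))))
        (differentiableAt_id.cpow_const h)
    · have hsq : ∀ w : ℂ, (Complex.I * (-w) ^ (1 / 2 : ℂ)) ^ 2 = w := fun w => by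
        rw [mul_pow, cpow_half_sq, Complex.I_sq]; ring
      have : G = f ∘ fun w : ℂ => Complex.I * (-w) ^ (1 / 2 : ℂ) := by
        ext w
        rw [comp_apply, ← hGsq, hsq]
      rw [this]
      exact DifferentiableAt.comp w
        (hd.differentiableAt (isOpen_puncturedHippopede.mem_nhds (hmem hw (hsq w))))
        ((differentiableAt_id.neg.cpow_const h).const_mul _)
  have hnhds : insert 0 (puncturedLimacon A β) ∈ 𝓝 (0 : ℂ) :=
    (isOpen_insert_puncturedLimacon hA).mem_nhds (mem_insert _ _)
  have hnhds' : insert 0 (puncturedHippopede A β) ∈ 𝓝 (0 : ℂ) := by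
    have h1 : ContinuousAt (fun z : ℂ => z ^ 2) 0 := (continuous_pow 2).continuousAt
    have h2 := h1.preimage_mem_nhds (t := insert 0 (puncturedLimacon A β)) (by simpa using hnhds)
    filter_upwards [h2] with z hz
    rcases hz with hz | hz
    · exact Or.inl (pow_eq_zero_iff two_ne_zero |>.1 hz)
    · exact Or.inr hz
  have hfo := isLittleO_inv_sq_of_integrableOn hnhds' hd hf
  have hroot : Tendsto (fun w : ℂ => w ^ (1 / 2 : ℂ)) (𝓝[≠] 0) (𝓝[≠] 0) := by
    refine tendsto_nhdsWithin_iff.2 ⟨?_, ?_⟩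
    · have h1 : Tendsto (fun w : ℂ => ‖w‖ ^ (1 / 2 : ℝ)) (𝓝 0) (𝓝 0) := by
        have : Continuous fun w : ℂ => ‖w‖ ^ (1 / 2 : ℝ) :=
          continuous_norm.rpow_const fun _ => Or.inr (by norm_num)
        simpa using this.tendsto 0
      refine (squeeze_zero_norm (fun w => ?_) h1).mono_left nhdsWithin_le_nhds
      have : ‖w ^ (1 / 2 : ℂ)‖ ^ 2 = (‖w‖ ^ (1 / 2 : ℝ)) ^ 2 := by
        rw [← norm_pow, cpow_half_sq, ← Real.rpow_natCast, ← Real.rpow_mul (norm_nonneg _)]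
        norm_num
      exact ((pow_left_inj₀ (norm_nonneg _) (by positivity) two_ne_zero).1 this).le
    · filter_upwards [self_mem_nhdsWithin] with w hw h
      apply hw
      have h' : w ^ (1 / 2 : ℂ) = 0 := h
      exact (cpow_half_sq w).symm.trans (by rw [h']; simp)
  have hGo : G =o[𝓝[≠] 0] fun w => w⁻¹ := by
    have := hfo.comp_tendsto hroot
    refine this.congr (fun _ => rfl) fun w => ?_
    rw [comp_apply, cpow_half_sq]
  have hconst : (fun _ : ℂ => G 0) =o[𝓝[≠] 0] fun w : ℂ => w⁻¹ :=
    Asymptotics.isLittleO_const_left.2 (Or.inr (tendsto_norm_inv_nhdsNE_zero_atTop))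
  refine ⟨update G 0 (limUnder (𝓝[≠] 0) G),
    Complex.differentiableOn_update_limUnder_of_isLittleO hnhds
      (hGd.mono fun w hw => hw.1.resolve_left hw.2) ?_, fun z hz => ?_⟩
  · simpa using hGo.sub hconst
  · rw [update_of_ne, hGsq]
    intro h
    refine zero_notMem_puncturedLimacon (A := A) (β := β) ?_
    rw [← h]
    exact hz

theorem integral_even_hippopede {A β : ℝ} (hA : 2 * |β| < A) (hβ : β < 0) {f H : ℂ → ℂ}
    (hf : IntegrableOn f (puncturedHippopede A β))
    (hH : DifferentiableOn ℂ H (insert 0 (puncturedLimacon A β)))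
    (hfH : ∀ z ∈ puncturedHippopede A β, H (z ^ 2) = f z) :
    ∫ z in puncturedHippopede A β, f z = Real.pi * A * H β := by
  set Q : ℝ → ℝ := fun φ => A + 2 * β * Real.cos φ with hQ
  have hQpos : ∀ φ, 0 < Q φ := fun φ => by
    have h1 : |β * Real.cos φ| ≤ |β| := by
      rw [abs_mul]
      exact mul_le_of_le_one_right (abs_nonneg _) (Real.abs_cos_le_one φ)
    have h2 := neg_abs_le (β * Real.cos φ)
    simp only [hQ]
    linarith
  have hR : ∀ θ, HasDerivAt (fun θ => √(Q (2 * θ))) (deriv (fun θ => √(Q (2 * θ))) θ) θ :=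
    fun θ => by
      refine DifferentiableAt.hasDerivAt (DifferentiableAt.sqrt ?_ (hQpos _).ne')
      simp only [hQ]
      fun_prop
  have hRpos : ∀ θ, 0 < √(Q (2 * θ)) := fun θ => Real.sqrt_pos.2 (hQpos _)
  have hsq : ∀ s θ : ℝ, (((s * √(Q (2 * θ)) : ℝ) : ℂ) * Complex.exp (θ * Complex.I)) ^ 2 =
      ((s ^ 2 * Q (2 * θ) : ℝ) : ℂ) * Complex.exp ((2 * θ : ℝ) * Complex.I) := fun s θ => by
    rw [mul_pow, ← Complex.ofReal_pow, mul_pow, Real.sq_sqrt (hQpos _).le, ← Complex.exp_nat_mul]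
    push_cast
    ring_nf
  have hS : ∀ s θ : ℝ, 0 < s → (((s * √(Q (2 * θ)) : ℝ) : ℂ) * Complex.exp (θ * Complex.I) ∈
      puncturedHippopede A β ↔ s < 1) := fun s θ hs => by
    have hq := hQpos (2 * θ)
    have hA' : A = Q (2 * θ) - 2 * β * Real.cos (2 * θ) := by simp only [hQ]; ring
    rw [puncturedHippopede, mem_preimage, hsq, puncturedLimacon, mem_ofPred_eq, norm_mul,
      Complex.norm_exp_ofReal_mul_I, Complex.re_ofReal_mul, Complex.exp_ofReal_mul_I_re,
      Complex.norm_real, Real.norm_of_nonneg (by positivity), mul_one]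
    have : A * (s ^ 2 * Q (2 * θ)) + 2 * β * (s ^ 2 * Q (2 * θ) * Real.cos (2 * θ)) -
        (s ^ 2 * Q (2 * θ)) ^ 2 = (s * Q (2 * θ)) ^ 2 * (1 - s ^ 2) := by
      linear_combination (s ^ 2 * Q (2 * θ)) * hA'
    rw [← sub_pos, this, mul_pos_iff_of_pos_left (by positivity), sub_pos, sq_lt_one_iff₀ hs.le]
  rw [integral_eq_radial_integral hR hRpos hS hf, ← integral_deriv_rescaled hA hβ hH]
  refine setIntegral_congr_fun measurableSet_Ioo fun s hs => ?_
  set F : ℝ → ℂ := fun φ => (Q φ : ℂ) *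
    H (((s ^ 2 * Q φ : ℝ) : ℂ) * Complex.exp (φ * Complex.I)) with hF
  have hFper : F.Periodic (2 * Real.pi) := fun φ => by
    have h1 : Q (φ + 2 * Real.pi) = Q φ := by simp [hQ]
    have h2 : Complex.exp ((φ + 2 * Real.pi : ℝ) * Complex.I) = Complex.exp (φ * Complex.I) := by
      push_cast
      rw [add_mul, Complex.exp_add, Complex.exp_two_pi_mul_I, mul_one]
    simp only [hF, h1, h2]
  have hFc : Continuous F := by
    have hQc : Continuous Q := by fun_prop
    refine (Complex.continuous_ofReal.comp hQc).mul
      (hH.continuousOn.comp_continuous (by fun_prop) fun φ => Or.inr ?_)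
    have h1 := hsq s (φ / 2)
    rw [mul_div_cancel₀ φ two_ne_zero] at h1
    have h2 := (hS s (φ / 2) hs.1).2 hs.2
    rw [mul_div_cancel₀ φ two_ne_zero, puncturedHippopede, mem_preimage, h1] at h2
    exact h2
  have hint : ∀ θ : ℝ, (s * √(Q (2 * θ)) ^ 2) •
      f (((s * √(Q (2 * θ)) : ℝ) : ℂ) * Complex.exp (θ * Complex.I)) = (s : ℂ) * F (2 * θ) :=
    fun θ => by
      rw [← hfH _ ((hS s θ hs.1).2 hs.2), hsq, Real.sq_sqrt (hQpos _).le, Complex.real_smul]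
      simp only [hF]
      push_cast
      ring
  have hdouble : ∫ θ in Ioo (-Real.pi) Real.pi, F (2 * θ) = ∫ φ in (0 : ℝ)..2 * Real.pi, F φ := by
    have hper2 : Function.Periodic (fun θ => F (2 * θ)) Real.pi := fun θ => by
      simp only [mul_add, hFper _]
    have hper2' : Function.Periodic (fun θ => F (2 * θ)) (2 * Real.pi) := by
      simpa using hper2.nat_mul 2
    rw [setIntegral_Ioo_neg_pi_pi_eq hper2']
    have h1 := intervalIntegral.integral_comp_mul_left (a := 0) (b := 2 * Real.pi) F two_ne_zero
    have h2 := hFper.intervalIntegral_add_zsmul_eq 2 0 fun t₁ t₂ => hFc.intervalIntegrable t₁ t₂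
    simp only [zero_add, mul_zero] at h1 h2
    rw [h1, show 2 * (2 * Real.pi) = (2 : ℤ) • (2 * Real.pi) by simp, h2, Complex.real_smul,
      zsmul_eq_mul]
    push_cast
    ring
  simp only [hint]
  rw [integral_const_mul, hdouble, integral_limacon_circle hA hs.1 hs.2 hH]

/-- Quadrature identity for the hippopede (Neumann oval): with `a > b > 0`,
`c = √(a² - b²)`, and `Ω = {x + iy : a²b²(x²+y²)² < b²x² + a²y²}` (the inversion of
the ellipse `x²/a² + y²/b² = 1` under the antipodal map), every integrable
holomorphic `h` on `Ω` satisfies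
`(1/π) ∫_Ω h dA = ((a²+b²)/(4a²b²)) (h(ic/(2ab)) + h(-ic/(2ab)))`. -/
theorem hippopede_quadrature (a b : ℝ) (hab : b < a) (hb : 0 < b) (h : ℂ → ℂ)
    (hhol : DifferentiableOn ℂ h
      {z : ℂ | a ^ 2 * b ^ 2 * (z.re ^ 2 + z.im ^ 2) ^ 2
        < b ^ 2 * z.re ^ 2 + a ^ 2 * z.im ^ 2})
    (hint : IntegrableOn h
      {z : ℂ | a ^ 2 * b ^ 2 * (z.re ^ 2 + z.im ^ 2) ^ 2
        < b ^ 2 * z.re ^ 2 + a ^ 2 * z.im ^ 2} volume) :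
    (1 / (Real.pi : ℂ)) *
        ∫ z in {z : ℂ | a ^ 2 * b ^ 2 * (z.re ^ 2 + z.im ^ 2) ^ 2
          < b ^ 2 * z.re ^ 2 + a ^ 2 * z.im ^ 2}, h z
      = (((a ^ 2 + b ^ 2) / (4 * a ^ 2 * b ^ 2) : ℝ) : ℂ) *
          (h (Complex.I * ((Real.sqrt (a ^ 2 - b ^ 2) / (2 * a * b) : ℝ) : ℂ))
            + h (-(Complex.I * ((Real.sqrt (a ^ 2 - b ^ 2) / (2 * a * b) : ℝ) : ℂ)))) := by
  set A : ℝ := (1 / a ^ 2 + 1 / b ^ 2) / 2 with hA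
  set β : ℝ := (1 / a ^ 2 - 1 / b ^ 2) / 4 with hβ
  have ha : 0 < a := hb.trans hab
  have hΩ : {z : ℂ | a ^ 2 * b ^ 2 * (z.re ^ 2 + z.im ^ 2) ^ 2
      < b ^ 2 * z.re ^ 2 + a ^ 2 * z.im ^ 2} = puncturedHippopede A β := by
    ext z
    have h1 : ‖z‖ ^ 2 = z.re ^ 2 + z.im ^ 2 := by
      rw [Complex.sq_norm, Complex.normSq_apply]; ring
    have h2 : (z ^ 2).re = z.re ^ 2 - z.im ^ 2 := by simp [pow_two]
    have h3 : b ^ 2 * z.re ^ 2 + a ^ 2 * z.im ^ 2 = a ^ 2 * b ^ 2 *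
        (A * (z.re ^ 2 + z.im ^ 2) + 2 * β * (z.re ^ 2 - z.im ^ 2)) := by
      rw [hA, hβ]
      field_simp
      ring
    rw [puncturedHippopede, mem_preimage, puncturedLimacon, mem_ofPred_eq, mem_ofPred_eq, norm_pow,
      h1, h2, h3, mul_lt_mul_iff_right₀ (by positivity)]
  rw [hΩ] at hhol hint ⊢
  have hinv : 1 / a ^ 2 < 1 / b ^ 2 :=
    one_div_lt_one_div_of_lt (by positivity) (by nlinarith)
  have hβneg : β < 0 := by rw [hβ]; linarith
  have hAβ : 2 * |β| < A := by
    rw [abs_of_neg hβneg, hA, hβ]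
    have : 0 < 1 / a ^ 2 := by positivity
    linarith
  have hpre : (fun z : ℂ => -z) ⁻¹' puncturedHippopede A β = puncturedHippopede A β := by
    ext z
    exact neg_mem_puncturedHippopede
  have hmp : MeasurePreserving (fun z : ℂ => -z) := Measure.measurePreserving_neg volume
  have hme : MeasurableEmbedding (fun z : ℂ => -z) := (MeasurableEquiv.neg ℂ).measurableEmbedding
  have hintneg : IntegrableOn (fun z => h (-z)) (puncturedHippopede A β) := by
    have := (hmp.integrableOn_comp_preimage hme).2 hint
    rwa [hpre] at this
  have hholneg : DifferentiableOn ℂ (fun z => h (-z)) (puncturedHippopede A β) :=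
    hhol.comp differentiable_neg.differentiableOn fun _ hz => neg_mem_puncturedHippopede.2 hz
  have hneg : ∫ z in puncturedHippopede A β, h (-z) = ∫ z in puncturedHippopede A β, h z := by
    have := hmp.setIntegral_preimage_emb hme h (puncturedHippopede A β)
    rwa [hpre] at this
  have hsumint : IntegrableOn (fun z => h z + h (-z)) (puncturedHippopede A β) := hint.add hintneg
  obtain ⟨H, hH, hHf⟩ := exists_differentiableOn_comp_sq hAβ (f := fun z => h z + h (-z))
    (fun z => by simp [add_comm]) (hhol.add hholneg) hsumint
  have hmain := integral_even_hippopede hAβ hβneg hsumint hH hHf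
  rw [integral_add hint hintneg, hneg] at hmain
  set p : ℂ := Complex.I * ((√(a ^ 2 - b ^ 2) / (2 * a * b) : ℝ) : ℂ) with hp
  have hpsq : p ^ 2 = β := by
    rw [hp, mul_pow, Complex.I_sq, ← Complex.ofReal_pow, div_pow, Real.sq_sqrt (by nlinarith),
      ← Complex.ofReal_one, ← Complex.ofReal_neg, ← Complex.ofReal_mul, hβ]
    congr 1
    field_simp
    ring
  have hpmem : p ∈ puncturedHippopede A β := by
    rw [puncturedHippopede, mem_preimage, hpsq]
    exact ofReal_mem_puncturedLimacon hAβ hβneg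
  rw [← hpsq, hHf p hpmem] at hmain
  have hcoef : (a ^ 2 + b ^ 2) / (4 * a ^ 2 * b ^ 2) = A / 2 := by
    rw [hA]
    field_simp
    ring
  have hpi : (Real.pi : ℂ) ≠ 0 := by exact_mod_cast Real.pi_ne_zero
  rw [hcoef]
  push_cast
  field_simp
  linear_combination hmain
end

section
/- Local residue cancellation lemma: let U be an open neighborhood of 0 in ℂ, let f, g, h be holomorphic on U, and suppose f has a zero of order exactly k ≥ 1 at 0. Then for all sufficiently small ε > 0, the function ζ ↦ h(ζ) f′(ζ)/(f(ζ)(1 + f(ζ) g(ζ))) is holomorphic on a punctured neighborhood of 0 containing the circle |ζ| = ε, and (1/(2πi)) ∮_{|ζ| = ε} h(ζ) f′(ζ)/(f(ζ)(1 + f(ζ) g(ζ))) dζ = k · h(0). -/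
open MeasureTheory

/-- Local residue cancellation lemma: if `f, g, h` are holomorphic near `0` and `f`
has a zero of order exactly `k ≥ 1` at `0`, then for all sufficiently small `ε > 0`
the function `ζ ↦ h(ζ) f′(ζ)/(f(ζ)(1 + f(ζ)g(ζ)))` is holomorphic on a punctured
neighborhood of `0` containing the circle `|ζ| = ε`, and
`(1/(2πi)) ∮_{|ζ|=ε} h(ζ) f′(ζ)/(f(ζ)(1 + f(ζ)g(ζ))) dζ = k·h(0)`. -/
theorem local_residue_cancellation (U : Set ℂ) (hU : IsOpen U) (h0 : (0 : ℂ) ∈ U)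
    (f g h : ℂ → ℂ)
    (hf : DifferentiableOn ℂ f U) (hg : DifferentiableOn ℂ g U)
    (hh : DifferentiableOn ℂ h U) (k : ℕ) (hk : 1 ≤ k)
    (horder : ∃ φ : ℂ → ℂ, DifferentiableOn ℂ φ U ∧ φ 0 ≠ 0 ∧
      ∀ z ∈ U, f z = z ^ k * φ z) :
    ∃ ε₀ : ℝ, 0 < ε₀ ∧ ∀ ε : ℝ, 0 < ε → ε < ε₀ →
      DifferentiableOn ℂ
        (fun ζ : ℂ => h ζ * deriv f ζ / (f ζ * (1 + f ζ * g ζ)))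
        (Metric.closedBall (0 : ℂ) ε \ {0}) ∧
      (1 / (2 * (Real.pi : ℂ) * Complex.I)) *
          (∮ ζ in C(0, ε), h ζ * deriv f ζ / (f ζ * (1 + f ζ * g ζ)))
        = (k : ℂ) * h 0 := by
  obtain ⟨φ, hφ, hφ0, hfac⟩ := horder
  have hk0 : k ≠ 0 := by omega
  have hf0 : f 0 = 0 := by simp [hfac 0 h0, hk0]
  have hd : DifferentiableOn ℂ (deriv f) U := hf.deriv hU
  have hφd : DifferentiableOn ℂ (deriv φ) U := hφ.deriv hU
  have hU0 : U ∈ nhds (0 : ℂ) := hU.mem_nhds h0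
  have hc1 : ContinuousAt (fun z => 1 + f z * g z) 0 :=
    continuousAt_const.add
      ((hf.continuousOn.continuousAt hU0).mul (hg.continuousOn.continuousAt hU0))
  have hev : ∀ᶠ z in nhds (0 : ℂ), z ∈ U ∧ φ z ≠ 0 ∧ 1 + f z * g z ≠ 0 :=
    Filter.Eventually.and hU0
      (((hφ.continuousOn.continuousAt hU0).eventually_ne hφ0).and
        (hc1.eventually_ne (by simp [hf0])))
  obtain ⟨ε₀, hε₀, hball⟩ := Metric.eventually_nhds_iff.1 hev
  refine ⟨ε₀, hε₀, fun ε hε hlt => ?_⟩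
  have hgood : ∀ z ∈ Metric.closedBall (0 : ℂ) ε, z ∈ U ∧ φ z ≠ 0 ∧ 1 + f z * g z ≠ 0 :=
    fun z hz => hball (lt_of_le_of_lt hz hlt)
  have hsub : Metric.closedBall (0 : ℂ) ε ⊆ U := fun z hz => (hgood z hz).1
  constructor
  · have hsub' : Metric.closedBall (0 : ℂ) ε \ {0} ⊆ U := Set.sdiff_subset.trans hsub
    refine ((hh.mul hd).mono hsub').fun_div
      ((hf.mul ((hf.mul hg).const_add 1)).mono hsub') fun z hz => ?_
    obtain ⟨hzU, hz1, hz2⟩ := hgood z hz.1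
    have hz0 : z ≠ 0 := hz.2
    refine mul_ne_zero ?_ hz2
    rw [hfac z hzU]
    exact mul_ne_zero (pow_ne_zero _ hz0) hz1
  let G : ℂ → ℂ := fun z => h z * (k * φ z + z * deriv φ z) / (φ z * (1 + f z * g z))
  have hG : DifferentiableOn ℂ G (Metric.closedBall 0 ε) := by
    refine DifferentiableOn.fun_div
      ((hh.mul ((hφ.const_mul (k : ℂ)).add (differentiableOn_id.mul hφd))).mono hsub)
      ((hφ.mul ((hf.mul hg).const_add 1)).mono hsub) fun z hz => ?_
    exact mul_ne_zero (hgood z hz).2.1 (hgood z hz).2.2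
  have hcauchy := hG.circleIntegral_sub_inv_smul (Metric.mem_ball_self hε)
  have hcongr : (∮ ζ in C(0, ε), h ζ * deriv f ζ / (f ζ * (1 + f ζ * g ζ))) =
      ∮ ζ in C(0, ε), (ζ - 0)⁻¹ • G ζ := by
    refine circleIntegral.integral_congr hε.le fun z hz => ?_
    obtain ⟨hzU, hz1, hz2⟩ := hgood z (Metric.sphere_subset_closedBall hz)
    have hz0 : z ≠ 0 := ne_of_mem_of_not_mem hz (by simp [hε.ne])
    have hderiv : deriv f z = k * z ^ (k - 1) * φ z + z ^ k * deriv φ z := by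
      have hfz : f =ᶠ[nhds z] fun w => w ^ k * φ w :=
        Filter.eventually_of_mem (hU.mem_nhds hzU) hfac
      rw [hfz.deriv_eq]
      exact ((hasDerivAt_pow k z).mul
        (hφ.differentiableAt (hU.mem_nhds hzU)).hasDerivAt).deriv
    have hpow : z ^ k = z ^ (k - 1) * z := (pow_sub_one_mul hk0 z).symm
    have hfz : f z = z ^ (k - 1) * z * φ z := by rw [hfac z hzU, hpow]
    have hz3 : z ^ (k - 1) ≠ 0 := pow_ne_zero _ hz0
    simp only [G, smul_eq_mul, sub_zero, hderiv, hpow]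
    generalize 1 + f z * g z = w at hz2 ⊢
    rw [hfz]
    field_simp
  rw [hcongr, hcauchy]
  have hG0 : G 0 = k * h 0 := by
    simp only [G, hf0]
    field_simp
    ring
  rw [hG0, smul_eq_mul, ← mul_assoc, one_div_mul_cancel Complex.two_pi_I_ne_zero, one_mul]
end
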